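/- In PG(5,5), the largest maximal partial line spread that is not a spread has size 647; that is, there exists a maximal partial line spread of size 647, and every maximal partial line spread of size greater than 647 has size 651 (the size of a spread), so the largest maximal partial line spread of positive deficiency has deficiency δ = (q+3)/2 = 4. -/

import Mathlib

/-- A partial line spread of PG(n-1, q): a set of lines (2-dimensional linear
subspaces of `F^n`) that are pairwise skew, i.e. pairwise intersecting only
in the zero subspace. -/
def IsPartialLineSpread (F : Type*) [Field F] (n : ℕ)
    (S : Set (Submodule F (Fin n → F))) : Prop :=
  (∀ l ∈ S, Module.finrank F ↥l = 2) ∧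
  (∀ l ∈ S, ∀ l' ∈ S, l ≠ l' → l ⊓ l' = ⊥)

/-- A maximal partial line spread: a partial line spread such that every line
of the space meets some line of the spread nontrivially (equivalently, it
cannot be extended to a larger partial line spread). -/
def IsMaximalPartialLineSpread (F : Type*) [Field F] (n : ℕ)
    (S : Set (Submodule F (Fin n → F))) : Prop :=
  IsPartialLineSpread F n S ∧
  ∀ m : Submodule F (Fin n → F), Module.finrank F ↥m = 2 → ∃ l ∈ S, m ⊓ l ≠ ⊥

open Finset Module

section Pencil

variable {F W ι : Type*} [Field F] [AddCommGroup W] [Module F W]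

/-- The members of the pencil of hyperplanes spanned by two linear forms. -/
def pencil (g₁ g₂ : Dual F W) : Option F → Dual F W
  | none => g₂
  | some c => g₁ + c • g₂

@[simp] theorem pencil_none (g₁ g₂ : Dual F W) : pencil g₁ g₂ none = g₂ := rfl

@[simp] theorem pencil_some (g₁ g₂ : Dual F W) (c : F) :
    pencil g₁ g₂ (some c) = g₁ + c • g₂ := rfl

open scoped Classical in
theorem sum_card_pencil [Fintype F] (g₁ g₂ : Dual F W) (T : Finset ι) (p : ι → W) :
    ∑ i, #{t ∈ T | pencil g₁ g₂ i (p t) = 0} =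
      #T + Fintype.card F * #{t ∈ T | g₁ (p t) = 0 ∧ g₂ (p t) = 0} := by
  simp only [card_filter]
  rw [sum_comm, mul_sum, card_eq_sum_ones, ← sum_add_distrib]
  refine sum_congr rfl fun t _ => ?_
  rw [Fintype.sum_option]
  simp only [pencil_none, pencil_some, LinearMap.add_apply, LinearMap.smul_apply, smul_eq_mul]
  by_cases hb : g₂ (p t) = 0
  · by_cases ha : g₁ (p t) = 0 <;> simp [ha, hb]
  · have : ∀ c : F, g₁ (p t) + c * g₂ (p t) = 0 ↔ c = -g₁ (p t) / g₂ (p t) := by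
      intro c
      rw [eq_div_iff hb, add_comm, add_eq_zero_iff_eq_neg]
    simp [this, hb]

theorem exists_pencil_apply_eq_zero (g₁ g₂ : Dual F W) (x : W) :
    ∃ i, pencil g₁ g₂ i x = 0 := by
  by_cases hb : g₂ x = 0
  · exact ⟨none, hb⟩
  · exact ⟨some (-g₁ x / g₂ x), by simp [hb]⟩

theorem exists_pencil_of_finrank_eq_three (hW : finrank F W = 3) {x : W} (hx : x ≠ 0) :
    ∃ g₁ g₂ : Dual F W, (∀ y, (g₁ y = 0 ∧ g₂ y = 0) ↔ y ∈ Submodule.span F {x}) ∧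
      ∀ i, pencil g₁ g₂ i ≠ 0 := by
  have : FiniteDimensional F W := FiniteDimensional.of_finrank_pos (by omega)
  have hQ : finrank F (W ⧸ Submodule.span F {x}) = 2 := by
    have h₁ := Submodule.finrank_quotient_add_finrank (Submodule.span F {x})
    rw [finrank_span_singleton hx] at h₁
    omega
  let b := finBasisOfFinrankEq F _ hQ
  let q := (Submodule.span F {x}).mkQ
  refine ⟨b.coord 0 ∘ₗ q, b.coord 1 ∘ₗ q, fun y => ?_, fun i hi => ?_⟩
  · rw [← Submodule.Quotient.mk_eq_zero, ← Submodule.mkQ_apply, ← b.forall_coord_eq_zero_iff]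
    simp [Fin.forall_fin_two, q]
  · obtain ⟨y₀, hy₀⟩ := Submodule.mkQ_surjective _ (b 0)
    obtain ⟨y₁, hy₁⟩ := Submodule.mkQ_surjective _ (b 1)
    cases i with
    | none => simpa [q, hy₁] using LinearMap.congr_fun hi y₁
    | some c => simpa [q, hy₀] using LinearMap.congr_fun hi y₀

theorem mem_span_of_apply_eq_zero (hW : finrank F W = 3) {g h : Dual F W} {x y z : W}
    (hg : g ≠ 0) (hgz : g z = 0) (hhz : h z ≠ 0) (hx : x ≠ 0) (hgx : g x = 0) (hhx : h x = 0)
    (hgy : g y = 0) (hhy : h y = 0) : y ∈ Submodule.span F {x} := by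
  have : FiniteDimensional F W := FiniteDimensional.of_finrank_pos (by omega)
  have hsurj : Function.Surjective (g.prod h) := by
    rintro ⟨a, b⟩
    obtain ⟨w, hw⟩ := LinearMap.surjective hg a
    refine ⟨w + ((b - h w) / h z) • z, ?_⟩
    simp [hw, hgz, hhz]
  have hker : finrank F (LinearMap.ker (g.prod h)) = 1 := by
    have h₁ := LinearMap.finrank_range_add_finrank_ker (g.prod h)
    rw [LinearMap.range_eq_top.2 hsurj, finrank_top, finrank_prod, finrank_self] at h₁
    omega
  have hx' : (⟨x, by simp [hgx, hhx]⟩ : LinearMap.ker (g.prod h)) ≠ 0 := by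
    simpa [Subtype.ext_iff] using hx
  obtain ⟨c, hc⟩ := (finrank_eq_one_iff_of_nonzero' _ hx').1 hker ⟨y, by simp [hgy, hhy]⟩
  exact Submodule.mem_span_singleton.2 ⟨c, congrArg Subtype.val hc⟩

open scoped Classical in
/-- A line of a plane carries at most `d` times the number of its nonempty intersections with the
lines through a point off it, if all points have weight at most `d`. -/
theorem card_line_le [Fintype F] (hW : finrank F W = 3) {T : Finset ι} {p : ι → W}
    (hp : ∀ t ∈ T, p t ≠ 0) {d : ℕ}
    (hd : ∀ t ∈ T, #{u ∈ T | p u ∈ Submodule.span F {p t}} ≤ d) {g₁ g₂ h : Dual F W} {z : W}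
    (hne : ∀ i, pencil g₁ g₂ i ≠ 0) (hz₁ : g₁ z = 0) (hz₂ : g₂ z = 0) (hhz : h z ≠ 0)
    {I : Finset (Option F)}
    (hI : ∀ t ∈ T, h (p t) = 0 → ∀ i, pencil g₁ g₂ i (p t) = 0 → i ∈ I) :
    #{t ∈ T | h (p t) = 0} ≤ #I * d := by
  have hsub : {t ∈ T | h (p t) = 0} ⊆
      I.biUnion fun i => {t ∈ T | h (p t) = 0 ∧ pencil g₁ g₂ i (p t) = 0} := by
    intro t ht
    rw [mem_filter] at ht
    obtain ⟨i, hi⟩ := exists_pencil_apply_eq_zero g₁ g₂ (p t)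
    simp only [mem_biUnion, mem_filter]
    exact ⟨i, hI t ht.1 ht.2 i hi, ht.1, ht.2, hi⟩
  refine (card_le_card hsub).trans (card_biUnion_le_card_mul _ _ _ fun i _ => ?_)
  rcases Finset.eq_empty_or_nonempty {t ∈ T | h (p t) = 0 ∧ pencil g₁ g₂ i (p t) = 0} with he | ⟨t, ht⟩
  · simp [he]
  · rw [mem_filter] at ht
    refine le_trans (card_le_card fun u hu => ?_) (hd t ht.1)
    rw [mem_filter] at hu ⊢
    refine ⟨hu.1, mem_span_of_apply_eq_zero hW (hne i) (z := z) ?_ hhz (hp t ht.1) ht.2.2 ht.2.1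
      hu.2.2 hu.2.1⟩
    cases i <;> simp [hz₁, hz₂]

open scoped Classical in
/-- In a plane over the field with five elements, a weighted set of `6 * d + 5` points with
`d ≤ 2` all of whose line weights are `d` modulo `5` has a point of weight at least `5`. -/
theorem exists_five_le_card_mem_span [Fintype F] (hF : Fintype.card F = 5)
    (hW : finrank F W = 3) {T : Finset ι} {p : ι → W} (hp : ∀ t ∈ T, p t ≠ 0) {d : ℕ} (hd : d ≤ 2)
    (hT : #T = 6 * d + 5) (hg : ∀ g : Dual F W, g ≠ 0 → #{t ∈ T | g (p t) = 0} % 5 = d) :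
    ∃ t ∈ T, 5 ≤ #{u ∈ T | p u ∈ Submodule.span F {p t}} := by
  by_contra! hlt
  have hopt : Fintype.card (Option F) = 6 := by simp [hF]
  -- every point has weight at most `d`
  have hle : ∀ t ∈ T, #{u ∈ T | p u ∈ Submodule.span F {p t}} ≤ d := by
    intro t ht
    obtain ⟨g₁, g₂, hgs, hne⟩ := exists_pencil_of_finrank_eq_three hW (hp t ht)
    have hsum := sum_card_pencil g₁ g₂ T p
    simp only [hgs, hF, hT] at hsum
    obtain ⟨i, hi⟩ : ∃ i, #{u ∈ T | pencil g₁ g₂ i (p u) = 0} < d + 5 := by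
      by_contra! hcon
      have := sum_le_sum fun i (_ : i ∈ univ) => hcon i
      rw [hsum, sum_const, card_univ, hopt, smul_eq_mul] at this
      have := hlt t ht
      omega
    have hi' := hg _ (hne i)
    refine le_trans (card_le_card (t := {u ∈ T | pencil g₁ g₂ i (p u) = 0}) fun u hu => ?_)
      (by omega)
    rw [mem_filter] at hu ⊢
    have := (hgs _).2 hu.2
    refine ⟨hu.1, ?_⟩
    cases i <;> simp [this]
  -- some point has weight exactly `d`
  obtain ⟨t, ht, htd⟩ : ∃ t ∈ T, d ≤ #{u ∈ T | p u ∈ Submodule.span F {p t}} := by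
    by_contra! hcon
    obtain ⟨t, ht⟩ : T.Nonempty := card_pos.1 (by omega)
    obtain ⟨g₁, g₂, hgs, hne⟩ := exists_pencil_of_finrank_eq_three hW (hp t ht)
    have hsum := sum_card_pencil g₁ g₂ T p
    simp only [hF, hT] at hsum
    obtain ⟨i, hi⟩ : ∃ i, d < #{u ∈ T | pencil g₁ g₂ i (p u) = 0} := by
      by_contra! hcon
      have := sum_le_sum fun i (_ : i ∈ univ) => hcon i
      rw [hsum, sum_const, card_univ, hopt, smul_eq_mul] at this
      omega
    have hi' := hg _ (hne i)
    obtain ⟨z, hz⟩ := LinearMap.surjective (hne i) 1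
    have hz' : pencil g₁ g₂ i z ≠ 0 := by simp [hz]
    have hz0 : z ≠ 0 := by rintro rfl; simp at hz'
    obtain ⟨k₁, k₂, hks, hne'⟩ := exists_pencil_of_finrank_eq_three hW hz0
    obtain ⟨hk₁, hk₂⟩ := (hks z).2 (Submodule.mem_span_singleton_self z)
    have h₁ := card_line_le hW hp (d := d - 1) (fun u hu => by have := hcon u hu; omega) hne'
      hk₁ hk₂ hz' (I := univ) (fun _ _ _ i _ => mem_univ i)
    rw [card_univ, hopt] at h₁
    have := hcon t ht
    omega
  replace htd := le_antisymm (hle t ht) htd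
  obtain ⟨g₁, g₂, hgs, hne⟩ := exists_pencil_of_finrank_eq_three hW (hp t ht)
  have hsum := sum_card_pencil g₁ g₂ T p
  simp only [hgs, hF, hT, htd] at hsum
  have hdle : ∀ i, {u ∈ T | p u ∈ Submodule.span F {p t}} ⊆
      {u ∈ T | pencil g₁ g₂ i (p u) = 0} := by
    intro i u hu
    rw [mem_filter] at hu ⊢
    have := (hgs _).2 hu.2
    refine ⟨hu.1, ?_⟩
    cases i <;> simp [this]
  -- the lines through this point carrying further points
  let I : Finset (Option F) := {i | d < #{u ∈ T | pencil g₁ g₂ i (p u) = 0}}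
  have hIcard : #I ≤ d + 1 := by
    have h₁ : ∑ i, (d + if i ∈ I then 5 else 0) ≤
        ∑ i, #{u ∈ T | pencil g₁ g₂ i (p u) = 0} := by
      refine sum_le_sum fun i _ => ?_
      have h₂ := hg _ (hne i)
      have h₃ := card_le_card (hdle i)
      split_ifs with hi
      · have := (mem_filter.1 hi).2
        omega
      · omega
    rw [hsum, sum_add_distrib, sum_const, card_univ, hopt, smul_eq_mul, sum_ite_mem, univ_inter,
      sum_const, smul_eq_mul] at h₁
    omega
  obtain ⟨i₀, hi₀⟩ : ∃ i, i ∉ I := by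
    by_contra! hcon
    have : I = univ := eq_univ_iff_forall.2 hcon
    rw [this, card_univ, hopt] at hIcard
    omega
  have hlight : ∀ i ∉ I, ∀ u ∈ T, pencil g₁ g₂ i (p u) = 0 → p u ∈ Submodule.span F {p t} := by
    intro i hi u hu hui
    have h₁ : #{u ∈ T | pencil g₁ g₂ i (p u) = 0} ≤ d := by simpa [I] using hi
    have h₂ := eq_of_subset_of_card_le (hdle i) (by omega)
    have h₃ : u ∈ {u ∈ T | pencil g₁ g₂ i (p u) = 0} := mem_filter.2 ⟨hu, hui⟩
    rw [← h₂] at h₃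
    exact (mem_filter.1 h₃).2
  obtain ⟨g₀, hg₀⟩ : ∃ g₀ : Dual F W, g₀ (p t) ≠ 0 := by
    by_contra! hcon
    exact hp t ht ((forall_dual_apply_eq_zero_iff F _).1 hcon)
  obtain ⟨ht₁, ht₂⟩ := (hgs (p t)).2 (Submodule.mem_span_singleton_self _)
  have hpt : ∀ i, pencil g₁ g₂ i (p t) = 0 := by intro i; cases i <;> simp [ht₁, ht₂]
  have hspan : ∀ u ∈ T, p u ∈ Submodule.span F {p t} → ∀ h : Dual F W, h (p t) ≠ 0 →
      h (p u) ≠ 0 := by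
    intro u hu hut h hh
    obtain ⟨c, hc⟩ := Submodule.mem_span_singleton.1 hut
    have hc0 : c ≠ 0 := by
      rintro rfl
      exact hp u hu (by simpa using hc.symm)
    rw [← hc, map_smul, smul_eq_mul]
    exact mul_ne_zero hc0 hh
  -- a line off this point carrying more than `d` points
  have hsum₀ := sum_card_pencil g₀ (pencil g₁ g₂ i₀) T p
  have hzero : #{u ∈ T | g₀ (p u) = 0 ∧ pencil g₁ g₂ i₀ (p u) = 0} = 0 := by
    rw [card_eq_zero, filter_eq_empty_iff]
    rintro u hu ⟨hu₁, hu₂⟩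
    exact hspan u hu (hlight i₀ hi₀ u hu hu₂) g₀ hg₀ hu₁
  rw [hzero, hT, Fintype.sum_option] at hsum₀
  have hi₀' : #{u ∈ T | pencil g₁ g₂ i₀ (p u) = 0} ≤ d := by simpa [I] using hi₀
  obtain ⟨c, hc⟩ : ∃ c, d < #{u ∈ T | pencil g₀ (pencil g₁ g₂ i₀) (some c) (p u) = 0} := by
    by_contra! hcon
    have := sum_le_sum fun c (_ : c ∈ univ) => hcon c
    rw [sum_const, card_univ, hF, smul_eq_mul] at this
    rw [pencil_none] at hsum₀
    omega
  set h := pencil g₀ (pencil g₁ g₂ i₀) (some c) with hh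
  have hht : h (p t) ≠ 0 := by simpa [hh, hpt i₀] using hg₀
  have h₁ := hg h fun h0 => hht (by simp [h0])
  have h₂ := card_line_le hW hp hle hne ht₁ ht₂ hht (I := I) fun u hu hhu i hi => by
    by_contra hiI
    exact hspan u hu (hlight i hiI u hu hi) h hht hhu
  have h₃ := Nat.mul_le_mul_right d hIcard
  interval_cases d <;> omega

end Pencil

section Projection

variable {F W ι : Type*} [Field F] [AddCommGroup W] [Module F W]

theorem mem_span_pair_of_mkQ {x y u : W}
    (h : (Submodule.span F {y}).mkQ u ∈ Submodule.span F {(Submodule.span F {y}).mkQ x}) :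
    u ∈ Submodule.span F {y, x} := by
  obtain ⟨c, hc⟩ := Submodule.mem_span_singleton.1 h
  rw [← map_smul, ← sub_eq_zero, ← map_sub, Submodule.mkQ_apply,
    Submodule.Quotient.mk_eq_zero, Submodule.mem_span_singleton] at hc
  obtain ⟨a, ha⟩ := hc
  refine Submodule.mem_span_pair.2 ⟨-a, c, ?_⟩
  rw [neg_smul, ha]
  abel

/-- Two vectors of a plane through `y` that are not proportional span `y`. -/
theorem exists_eq_smul_add_smul {x y v w : W} (hv : v ≠ 0)
    (hvm : v ∈ Submodule.span F {y, x}) (hwm : w ∈ Submodule.span F {y, x})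
    (hw : w ∉ Submodule.span F {v}) : ∃ a b : F, y = a • v + b • w := by
  obtain ⟨a, b, rfl⟩ := Submodule.mem_span_pair.1 hvm
  obtain ⟨c, d, rfl⟩ := Submodule.mem_span_pair.1 hwm
  have hdet : a * d - b * c ≠ 0 := by
    intro h0
    refine hw (Submodule.mem_span_singleton.2 ?_)
    by_cases ha : a = 0
    · have hb : b ≠ 0 := by
        rintro rfl
        simp [ha] at hv
      have hc : c = 0 := by
        rw [ha, zero_mul, zero_sub, neg_eq_zero] at h0
        exact (mul_eq_zero.1 h0).resolve_left hb
      refine ⟨d / b, ?_⟩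
      rw [ha, hc, zero_smul, zero_add, zero_add, smul_smul, div_mul_cancel₀ _ hb]
    · refine ⟨c / a, ?_⟩
      rw [smul_add, smul_smul, smul_smul, div_mul_cancel₀ _ ha]
      congr 2
      field_simp
      linear_combination -h0
  refine ⟨d / (a * d - b * c), -b / (a * d - b * c), ?_⟩
  calc y = ((a * d - b * c)⁻¹ * (a * d - b * c)) • y := by rw [inv_mul_cancel₀ hdet, one_smul]
    _ = _ := by module

theorem mem_span_singleton_symm {v w : W} (hw : w ≠ 0) (h : w ∈ Submodule.span F {v}) :
    v ∈ Submodule.span F {w} := by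
  obtain ⟨c, rfl⟩ := Submodule.mem_span_singleton.1 h
  have hc : c ≠ 0 := by
    rintro rfl
    simp at hw
  exact Submodule.mem_span_singleton.2 ⟨c⁻¹, inv_smul_smul₀ hc v⟩

theorem mem_span_singleton_trans {u v w : W} (h : v ∈ Submodule.span F {u})
    (h' : w ∈ Submodule.span F {v}) : w ∈ Submodule.span F {u} :=
  (Submodule.span_singleton_le_iff_mem _ _).2 h h'

open scoped Classical in
/-- Among at least five vectors, at most four of which are multiples of a given one of them,
there are at least eight ordered pairs that are not proportional. -/
theorem eight_le_card_filter_notMem_span {U : Finset ι} {p : ι → W} (hp : ∀ u ∈ U, p u ≠ 0)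
    (hU : 5 ≤ #U) {t : ι} (ht : t ∈ U) (hcl : #{u ∈ U | p u ∈ Submodule.span F {p t}} ≤ 4) :
    8 ≤ #{x ∈ U ×ˢ U | p x.2 ∉ Submodule.span F {p x.1}} := by
  set C := {u ∈ U | p u ∈ Submodule.span F {p t}} with hC
  set D := {u ∈ U | p u ∉ Submodule.span F {p t}} with hD
  have hCD : #C + #D = #U := card_filter_add_card_filter_not _
  have hC1 : 1 ≤ #C := card_pos.2 ⟨t, mem_filter.2 ⟨ht, Submodule.mem_span_singleton_self _⟩⟩
  have hsub : C ×ˢ D ∪ D ×ˢ C ⊆ {x ∈ U ×ˢ U | p x.2 ∉ Submodule.span F {p x.1}} := by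
    rintro ⟨u, v⟩ hx
    simp only [mem_union, mem_product, hC, hD, mem_filter] at hx ⊢
    rcases hx with ⟨⟨hu, hu'⟩, hv, hv'⟩ | ⟨⟨hu, hu'⟩, hv, hv'⟩
    · exact ⟨⟨hu, hv⟩, fun h => hv' (mem_span_singleton_trans hu' h)⟩
    · exact ⟨⟨hu, hv⟩, fun h =>
        hu' (mem_span_singleton_trans hv' (mem_span_singleton_symm (hp v hv) h))⟩
  have hdisj : Disjoint (C ×ˢ D) (D ×ˢ C) := by
    rw [disjoint_left]
    rintro ⟨u, v⟩ hx hx'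
    simp only [mem_product, hC, hD, mem_filter] at hx hx'
    exact hx'.1.2 hx.1.2
  refine le_trans ?_ (card_le_card hsub)
  rw [card_union_of_disjoint hdisj, card_product, card_product]
  clear_value C D
  generalize #C = c at *
  generalize #D = e at *
  interval_cases c <;> omega

open scoped Classical in
/-- A weighted set of at most `17` points, each of weight at most `4`, in a space of projective
dimension at least `3` over the field with five elements can be projected from a suitable point
so that the weights of the image are again at most `4`. -/
theorem exists_projection_center [Fintype F] [FiniteDimensional F W] (hF : Fintype.card F = 5)
    (hW : 4 ≤ finrank F W) {T : Finset ι} {p : ι → W} (hT : #T ≤ 17) (hp : ∀ t ∈ T, p t ≠ 0)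
    (hcl : ∀ t ∈ T, #{u ∈ T | p u ∈ Submodule.span F {p t}} ≤ 4) :
    ∃ y : W, y ≠ 0 ∧ (∀ t ∈ T, p t ∉ Submodule.span F {y}) ∧
      ∀ t ∈ T, #{u ∈ T | p u ∈ Submodule.span F {y, p t}} ≤ 4 := by
  have : Finite W := Module.finite_of_finite F
  have : Fintype W := Fintype.ofFinite W
  let E : Finset F := univ.erase 0
  have hE : #E = 4 := by simp [E, hF]
  let B₁ : Finset W := (T ×ˢ E).image fun x => x.2 • p x.1
  have hB₁ : #B₁ ≤ 68 := by
    refine card_image_le.trans ?_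
    rw [card_product, hE]
    omega
  have hmem : ∀ t ∈ T, ∀ c : F, c ≠ 0 → c • p t ∈ B₁ := fun t ht c hc =>
    mem_image.2 ⟨(t, c), by simp [E, ht, hc], rfl⟩
  let B₂ : Finset W :=
    {y | y ≠ 0 ∧ y ∉ B₁ ∧ ∃ t ∈ T, 5 ≤ #{u ∈ T | p u ∈ Submodule.span F {y, p t}}}
  have hB₂ : #B₂ * 8 ≤ #T.offDiag * 16 := by
    refine card_mul_le_card_mul (fun y x => p x.2 ∉ Submodule.span F {p x.1} ∧
      ∃ a ∈ E, ∃ b ∈ E, a • p x.1 + b • p x.2 = y) (fun y hy => ?_) fun x hx => ?_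
    · simp only [B₂, mem_filter, mem_univ, true_and] at hy
      obtain ⟨hy0, hy₁, t, ht, htc⟩ := hy
      have htU : t ∈ {u ∈ T | p u ∈ Submodule.span F {y, p t}} :=
        mem_filter.2 ⟨ht, Submodule.subset_span (by simp)⟩
      refine (eight_le_card_filter_notMem_span (F := F) (fun u hu => hp u (mem_filter.1 hu).1) htc htU
        (le_trans (card_le_card ?_) (hcl t ht))).trans (card_le_card ?_)
      · exact filter_subset_filter _ (filter_subset _ _)
      · rintro ⟨u, v⟩ hx
        simp only [mem_filter, mem_product] at hx
        obtain ⟨⟨⟨hu, hu'⟩, hv, hv'⟩, huv⟩ := hx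
        obtain ⟨a, b, hab⟩ := exists_eq_smul_add_smul (hp u hu) hu' hv' huv
        rw [mem_bipartiteAbove, mem_offDiag]
        refine ⟨⟨hu, hv, ?_⟩, huv, a, ?_, b, ?_, hab.symm⟩
        · intro (h : u = v)
          exact huv (h ▸ Submodule.mem_span_singleton_self _)
        · refine mem_erase.2 ⟨?_, mem_univ _⟩
          rintro rfl
          refine hy₁ ?_
          rw [hab, zero_smul, zero_add]
          refine hmem v hv b ?_
          rintro rfl
          simp [hab] at hy0
        · refine mem_erase.2 ⟨?_, mem_univ _⟩
          rintro rfl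
          refine hy₁ ?_
          rw [hab, zero_smul, add_zero]
          refine hmem u hu a ?_
          rintro rfl
          simp [hab] at hy0
    · have hsub : bipartiteBelow (fun y x => p x.2 ∉ Submodule.span F {p x.1} ∧
          ∃ a ∈ E, ∃ b ∈ E, a • p x.1 + b • p x.2 = y) B₂ x ⊆
          (E ×ˢ E).image fun c => c.1 • p x.1 + c.2 • p x.2 := by
        intro y hy
        obtain ⟨-, -, a, ha, b, hb, hab⟩ := mem_bipartiteBelow _ |>.1 hy
        exact mem_image.2 ⟨(a, b), mem_product.2 ⟨ha, hb⟩, hab⟩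
      refine (card_le_card hsub).trans (card_image_le.trans ?_)
      rw [card_product, hE]
  have hoff : #T.offDiag ≤ 272 := by
    rw [offDiag_card]
    generalize #T = n at hT
    interval_cases n <;> omega
  have hcard : 625 ≤ Fintype.card W := by
    rw [Module.card_eq_pow_finrank (K := F) (V := W), hF]
    exact Nat.pow_le_pow_right (n := 5) (by norm_num) hW
  obtain ⟨y, -, hy⟩ : ∃ y ∈ univ, y ∉ {0} ∪ B₁ ∪ B₂ := by
    refine exists_mem_notMem_of_card_lt_card ?_
    have h₁ := card_union_le ({0} ∪ B₁) B₂
    have h₂ := card_union_le {0} B₁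
    rw [card_singleton] at h₂
    rw [card_univ]
    omega
  simp only [mem_union, mem_singleton, not_or] at hy
  obtain ⟨⟨hy0, hy₁⟩, hy₂⟩ := hy
  refine ⟨y, hy0, fun t ht hty => hy₁ ?_, fun t ht => ?_⟩
  · obtain ⟨c, hc⟩ := Submodule.mem_span_singleton.1 (mem_span_singleton_symm (hp t ht) hty)
    rw [← hc]
    refine hmem t ht c ?_
    rintro rfl
    exact hy0 (by simpa using hc.symm)
  · by_contra! hcon
    exact hy₂ (mem_filter.2 ⟨mem_univ _, hy0, hy₁, t, ht, hcon⟩)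

open scoped Classical in
/-- A weighted set of `6 * d + 5` points with `d ≤ 2`, all of whose hyperplane weights are `d`
modulo `5`, has a point of weight at least `5`. -/
theorem exists_five_le_card_mem_span_of_finrank [Fintype F] (hF : Fintype.card F = 5) {d : ℕ}
    (hd : d ≤ 2) {T : Finset ι} (hT : #T = 6 * d + 5) (n : ℕ) :
    ∀ {W : Type _} [AddCommGroup W] [Module F W], finrank F W = n + 3 →
    ∀ {p : ι → W}, (∀ t ∈ T, p t ≠ 0) →
    (∀ g : Dual F W, g ≠ 0 → #{t ∈ T | g (p t) = 0} % 5 = d) →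
    ∃ t ∈ T, 5 ≤ #{u ∈ T | p u ∈ Submodule.span F {p t}} := by
  induction n with
  | zero => exact fun hW _ hp hg => exists_five_le_card_mem_span hF hW hp hd hT hg
  | succ n ih =>
    intro W _ _ hW p hp hg
    by_contra! hcon
    have : FiniteDimensional F W := FiniteDimensional.of_finrank_pos (by omega)
    obtain ⟨y, hy0, hy₁, hy₂⟩ := exists_projection_center hF (by omega) (by omega) hp
      fun t ht => Nat.le_of_lt_succ (hcon t ht)
    let q := (Submodule.span F {y}).mkQ
    have hq : finrank F (W ⧸ Submodule.span F {y}) = n + 3 := by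
      have h₁ := Submodule.finrank_quotient_add_finrank (Submodule.span F {y})
      rw [finrank_span_singleton hy0] at h₁
      omega
    obtain ⟨t, ht, h5⟩ := ih hq (p := fun t => q (p t))
      (fun t ht h => hy₁ t ht ((Submodule.Quotient.mk_eq_zero _).1 h)) fun g hg0 => by
        refine hg (g ∘ₗ q) fun h0 => hg0 ?_
        refine LinearMap.ext fun x => ?_
        obtain ⟨z, rfl⟩ := Submodule.mkQ_surjective _ x
        exact LinearMap.congr_fun h0 z
    refine absurd (hy₂ t ht) (not_le.2 (lt_of_lt_of_le h5 (card_le_card fun u hu => ?_)))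
    rw [mem_filter] at hu ⊢
    exact ⟨hu.1, mem_span_pair_of_mkQ hu.2⟩

end Projection

theorem finrank_ker_inf_line {F V : Type*} [Field F] [AddCommGroup V] [Module F V]
    [FiniteDimensional F V] {f : Dual F V} {l : Submodule F V}
    (hl : finrank F l = 2) :
    finrank F (LinearMap.ker f ⊓ l : Submodule F V) = 1 ∨
      finrank F (LinearMap.ker f ⊓ l : Submodule F V) = 2 := by
  have h₁ : finrank F (LinearMap.ker f ⊓ l : Submodule F V) ≤ finrank F l :=
    Submodule.finrank_mono inf_le_right
  have h₂ := Submodule.finrank_sup_add_finrank_inf_eq (LinearMap.ker f) l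
  have h₃ := LinearMap.finrank_range_add_finrank_ker f
  have h₄ : finrank F (LinearMap.range f) ≤ 1 := by
    simpa using Submodule.finrank_le (LinearMap.range f)
  have h₅ : finrank F (LinearMap.ker f ⊔ l : Submodule F V) ≤ finrank F V :=
    Submodule.finrank_le _
  omega


open scoped Classical in
/-- A system of representatives, up to nonzero scalars, of a set of nonzero vectors. -/
theorem exists_representatives {F V : Type*} [Field F] [Fintype F] [AddCommGroup V] [Module F V]
    {A : Finset V} (hA0 : 0 ∉ A)
    (hA : ∀ v ∈ A, ∀ c : F, c ≠ 0 → c • v ∈ A) :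
    ∃ H ⊆ A, (∀ u ∈ H, ∀ v ∈ H, v ∈ Submodule.span F {u} → u = v) ∧
      ∀ U : Submodule F V,
        #{v ∈ A | v ∈ U} = (Fintype.card F - 1) * #{v ∈ H | v ∈ U} := by
  let r : V → V := fun v => if h : v = 0 then 0 else (Projectivization.mk F v h).rep
  have hr : ∀ v, v ≠ 0 → ∃ c : F, c ≠ 0 ∧ c • v = r v := by
    intro v hv
    obtain ⟨a, ha⟩ := Projectivization.exists_smul_eq_mk_rep F v hv
    exact ⟨a, a.ne_zero, by simp only [r, hv, dite_false]; exact ha⟩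
  have hrs : ∀ v, v ≠ 0 → ∀ c : F, c ≠ 0 → r (c • v) = r v := by
    intro v hv c hc
    have h₁ : c • v ≠ 0 := smul_ne_zero hc hv
    simp only [r, hv, h₁, dite_false]
    exact congrArg _ ((Projectivization.mk_eq_mk_iff' F _ _ h₁ hv).2 ⟨c, rfl⟩)
  have hne : ∀ v ∈ A, v ≠ 0 := fun v hv h => hA0 (h ▸ hv)
  refine ⟨{v ∈ A | r v = v}, filter_subset _ _, fun u hu v hv huv => ?_, fun U => ?_⟩
  · rw [mem_filter] at hu hv
    obtain ⟨c, rfl⟩ := Submodule.mem_span_singleton.1 huv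
    have hc : c ≠ 0 := by
      rintro rfl
      exact hne _ hv.1 (zero_smul _ _)
    exact hu.2.symm.trans ((hrs u (hne u hu.1) c hc).symm.trans hv.2)
  · rw [card_eq_sum_card_fiberwise (f := r) (t := {v ∈ {v ∈ A | r v = v} | v ∈ U}),
      sum_const_nat (m := Fintype.card F - 1), mul_comm]
    · intro h hh
      simp only [mem_filter] at hh
      obtain ⟨⟨hhA, hrh⟩, hhU⟩ := hh
      have hh0 := hne h hhA
      have : {v ∈ {v ∈ A | v ∈ U} | r v = h} = (univ.erase (0 : F)).image fun c => c • h := by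
        ext v
        simp only [mem_filter, mem_image, mem_erase, mem_univ, and_true]
        constructor
        · rintro ⟨⟨hvA, -⟩, hv⟩
          obtain ⟨c, hc, hcv⟩ := hr v (hne v hvA)
          exact ⟨c⁻¹, inv_ne_zero hc, by rw [← hv, ← hcv, inv_smul_smul₀ hc]⟩
        · rintro ⟨c, hc, rfl⟩
          exact ⟨⟨hA h hhA c hc, U.smul_mem c hhU⟩, by rw [hrs h hh0 c hc, hrh]⟩
      rw [this, card_image_of_injective _ (smul_left_injective F hh0), card_erase_of_mem (mem_univ _),
        card_univ]
    · intro v hv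
      simp only [mem_coe, mem_filter] at hv ⊢
      obtain ⟨c, hc, hcv⟩ := hr v (hne v hv.1)
      rw [← hcv]
      refine ⟨⟨hA v hv.1 c hc, ?_⟩, U.smul_mem c hv.2⟩
      rw [hrs v (hne v hv.1) c hc, hcv]

section Holes

variable {F V : Type*} [Field F] [Fintype F] [AddCommGroup V] [Module F V] [Fintype V]

open scoped Classical in
theorem card_filter_mem_submodule (U : Submodule F V) :
    #{v : V | v ≠ 0 ∧ v ∈ U} = Fintype.card F ^ finrank F U - 1 := by
  rw [← Module.card_eq_pow_finrank (K := F) (V := U), Fintype.card_subtype,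
    ← card_erase_of_mem (a := (0 : V)) (by simp)]
  congr 1
  ext v
  simp

open scoped Classical in
/-- The nonzero vectors on no line of the set `S`. -/
noncomputable def holes (S : Set (Submodule F V)) : Finset V :=
  {v | v ≠ 0 ∧ ∀ l ∈ S, v ∉ l}

open scoped Classical in
theorem card_holes_add_sum {S : Set (Submodule F V)}
    (hS : ∀ l ∈ S, ∀ l' ∈ S, l ≠ l' → l ⊓ l' = ⊥) (U : Submodule F V) :
    #{v ∈ holes S | v ∈ U} +
        ∑ l ∈ S.toFinset, (Fintype.card F ^ finrank F (U ⊓ l : Submodule F V) - 1) =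
      Fintype.card F ^ finrank F U - 1 := by
  simp only [← card_filter_mem_submodule]
  rw [← card_biUnion, ← card_union_of_disjoint]
  · congr 1
    ext v
    simp only [holes, mem_union, mem_filter, mem_biUnion, mem_univ, true_and, Set.mem_toFinset,
      Submodule.mem_inf]
    by_cases h : ∃ l ∈ S, v ∈ l
    · obtain ⟨l, hl, hv⟩ := h
      constructor
      · rintro (⟨⟨h₀, -⟩, hU⟩ | ⟨l', -, h₀, hU, -⟩) <;> exact ⟨h₀, hU⟩
      · rintro ⟨h₀, hU⟩
        exact Or.inr ⟨l, hl, h₀, hU, hv⟩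
    · push Not at h
      constructor
      · rintro (⟨⟨h₀, -⟩, hU⟩ | ⟨l', -, h₀, hU, -⟩) <;> exact ⟨h₀, hU⟩
      · rintro ⟨h₀, hU⟩
        exact Or.inl ⟨⟨h₀, h⟩, hU⟩
  · rw [disjoint_left]
    intro v hv hv'
    simp only [holes, mem_filter, mem_biUnion, mem_univ, true_and, Set.mem_toFinset,
      Submodule.mem_inf] at hv hv'
    obtain ⟨l, hl, -, -, hvl⟩ := hv'
    exact hv.1.2 l hl hvl
  · intro l hl l' hl' hne
    rw [Function.onFun, disjoint_left]
    intro v hv hv'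
    simp only [mem_filter, mem_univ, true_and, Submodule.mem_inf] at hv hv'
    have : v ∈ l ⊓ l' := ⟨hv.2.2, hv'.2.2⟩
    rw [hS l (by simpa using hl) l' (by simpa using hl') hne, Submodule.mem_bot] at this
    exact hv.1 this

end Holes

theorem IsMaximalPartialLineSpread.ncard_eq {F : Type*} [Field F] [Fintype F]
    (hF : Fintype.card F = 5) {S : Set (Submodule F (Fin 6 → F))}
    (hS : IsMaximalPartialLineSpread F 6 S) (hcard : 647 < S.ncard) : S.ncard = 651 := by
  classical
  obtain ⟨⟨hline, hskew⟩, hmax⟩ := hS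
  by_contra hne
  have hcount := card_holes_add_sum hskew
  rw [Set.ncard_eq_toFinset_card'] at hcard hne
  obtain ⟨H, hHA, hHspan, hHcard⟩ := exists_representatives (F := F) (A := holes S)
    (by simp [holes]) fun v hv c hc => by
      simp only [holes, mem_filter, mem_univ, true_and] at hv ⊢
      exact ⟨smul_ne_zero hc hv.1, fun l hl h => hv.2 l hl ((l.smul_mem_iff hc).1 h)⟩
  simp only [hHcard, hF] at hcount
  have htop := hcount ⊤
  rw [sum_const_nat (m := 24) fun l hl => by
    rw [top_inf_eq, hline l (by simpa using hl)]; norm_num, finrank_top, finrank_fin_fun] at htop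
  simp only [Submodule.mem_top, filter_true] at htop
  obtain ⟨d, hd⟩ : ∃ d, #S.toFinset + d + 1 = 651 := ⟨650 - #S.toFinset, by omega⟩
  have hH : #H = 6 * d + 6 := by omega
  have hker : ∀ f : Dual F (Fin 6 → F), f ≠ 0 → #{v ∈ H | f v = 0} % 5 = d + 1 := by
    intro f hf
    have h₁ := hcount (LinearMap.ker f)
    have h₂ : (∑ l ∈ S.toFinset, (5 ^ finrank F (LinearMap.ker f ⊓ l : Submodule F _) - 1)) % 20 =
        #S.toFinset * 4 % 20 := by
      rw [sum_nat_mod, sum_const_nat (m := 4)]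
      intro l hl
      rcases finrank_ker_inf_line (f := f) (hline l (by simpa using hl)) with h | h <;> simp [h]
    have h₃ : finrank F (LinearMap.ker f) = 5 := by
      have h₄ := LinearMap.finrank_range_add_finrank_ker f
      rw [LinearMap.range_eq_top.2 (LinearMap.surjective hf), finrank_top, finrank_self,
        finrank_fin_fun] at h₄
      omega
    rw [h₃] at h₁
    simp only [LinearMap.mem_ker] at h₁
    omega
  have hplane : ∀ m : Submodule F (Fin 6 → F), finrank F m = 2 → #{v ∈ H | v ∈ m} ≤ 5 := by
    intro m hm
    have h₁ := hcount m
    obtain ⟨l, hl, hml⟩ := hmax m hm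
    have h₂ : finrank F (m ⊓ l : Submodule F _) ≠ 0 := by rwa [Ne, Submodule.finrank_eq_zero]
    have h₃ := single_le_sum (f := fun l => 5 ^ finrank F (m ⊓ l : Submodule F _) - 1)
      (fun _ _ => Nat.zero_le _) (Set.mem_toFinset.2 hl)
    have h₄ : 5 ^ 1 ≤ 5 ^ finrank F (m ⊓ l : Submodule F _) :=
      Nat.pow_le_pow_right (by norm_num) (by omega)
    rw [hm] at h₁
    omega
  obtain ⟨P, hP⟩ : H.Nonempty := card_pos.1 (by omega)
  have hP0 : P ≠ 0 := by
    have := hHA hP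
    simp only [holes, mem_filter] at this
    exact this.2.1
  let q := (Submodule.span F {P}).mkQ
  have hq : finrank F ((Fin 6 → F) ⧸ Submodule.span F {P}) = 2 + 3 := by
    have h₁ := Submodule.finrank_quotient_add_finrank (Submodule.span F {P})
    rw [finrank_span_singleton hP0, finrank_fin_fun] at h₁
    omega
  have hnot : ∀ t ∈ H.erase P, t ∉ Submodule.span F {P} := fun t ht h =>
    (mem_erase.1 ht).1 (hHspan P hP t (mem_erase.1 ht).2 h).symm
  obtain ⟨t, ht, h5⟩ := exists_five_le_card_mem_span_of_finrank hF (d := d) (by omega)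
    (T := H.erase P) (by rw [card_erase_of_mem hP]; omega) 2 hq (p := q)
    (fun t ht h => hnot t ht ((Submodule.Quotient.mk_eq_zero _).1 h)) fun g hg0 => by
      have h₁ := hker (g ∘ₗ q) fun h0 => hg0 <| LinearMap.ext fun x => by
        obtain ⟨z, rfl⟩ := Submodule.mkQ_surjective _ x
        exact LinearMap.congr_fun h0 z
      have hPg : P ∈ {v ∈ H | (g ∘ₗ q) v = 0} := by
        refine mem_filter.2 ⟨hP, ?_⟩
        have : q P = 0 := (Submodule.Quotient.mk_eq_zero _).2 (Submodule.mem_span_singleton_self P)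
        rw [LinearMap.comp_apply, this, map_zero]
      have h₂ := card_pos.2 ⟨P, hPg⟩
      rw [filter_erase, card_erase_of_mem (by exact hPg)]
      simp only [LinearMap.comp_apply] at h₁ h₂
      omega
  have hspan : finrank F (Submodule.span F {P, t}) = 2 := by
    have hli : LinearIndependent F ![P, t] :=
      (LinearIndependent.pair_iff' hP0).2 fun a ha =>
        hnot t ht (Submodule.mem_span_singleton.2 ⟨a, ha⟩)
    rw [← Matrix.range_cons_cons_empty P t ![], finrank_span_eq_card hli, Fintype.card_fin]
  have hsub : insert P {u ∈ H.erase P | q u ∈ Submodule.span F {q t}} ⊆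
      {v ∈ H | v ∈ Submodule.span F {P, t}} := by
    intro u hu
    rw [mem_insert, mem_filter] at hu
    rw [mem_filter]
    rcases hu with rfl | ⟨hu, huq⟩
    · exact ⟨hP, Submodule.subset_span (by simp)⟩
    · refine ⟨(mem_erase.1 hu).2, ?_⟩
      exact mem_span_pair_of_mkQ huq
  have h₆ := card_le_card hsub
  rw [card_insert_of_notMem (by simp)] at h₆
  have := hplane _ hspan
  omega

/-- Matrices over the field with five elements with invertible pairwise differences such that
every matrix has a singular difference with one of them. -/
def maximalPartialSpreadSet : Fin 21 → Matrix (Fin 2) (Fin 2) (ZMod 5) :=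
  ![!![0, 0; 0, 0], !![0, 2; 3, 0], !![0, 3; 2, 0], !![0, 4; 1, 0], !![1, 1; 2, 3],
    !![1, 2; 0, 1], !![1, 3; 4, 4], !![1, 4; 1, 3], !![2, 1; 4, 0], !![2, 2; 1, 4],
    !![2, 3; 0, 2], !![2, 4; 3, 4], !![3, 0; 3, 2], !![3, 1; 1, 1], !![3, 2; 0, 3],
    !![3, 3; 4, 1], !![3, 4; 2, 2], !![4, 1; 4, 2], !![4, 2; 1, 2], !![4, 3; 3, 3],
    !![4, 4; 2, 1]]

theorem eq_of_det_maximalPartialSpreadSet_sub_eq_zero (i j : Fin 21)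
    (h : (maximalPartialSpreadSet i - maximalPartialSpreadSet j).det = 0) : i = j := by
  rw [Matrix.det_fin_two] at h
  simp only [Matrix.sub_apply] at h
  revert i j
  decide +kernel

theorem exists_det_sub_maximalPartialSpreadSet_eq_zero (N : Matrix (Fin 2) (Fin 2) (ZMod 5)) :
    ∃ i, (N - maximalPartialSpreadSet i).det = 0 := by
  simp only [Matrix.det_fin_two, Matrix.sub_apply]
  generalize N 0 0 = a, N 0 1 = b, N 1 0 = c, N 1 1 = d
  revert a b c d
  decide +kernel

theorem exists_maximal_partial_spread_set {F : Type*} [Field F] [Fintype F]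
    (hF : Fintype.card F = 5) :
    ∃ M : Fin 21 → Matrix (Fin 2) (Fin 2) F,
      (∀ i j, (M i - M j).det = 0 → i = j) ∧ ∀ N, ∃ i, (N - M i).det = 0 := by
  let φ : ZMod 5 ≃+* F := ZMod.ringEquivOfPrime F (by norm_num) hF
  have hφ : ∀ A B : Matrix (Fin 2) (Fin 2) (ZMod 5),
      (A.map φ - B.map φ).det = φ (A - B).det := by
    intro A B
    simp [Matrix.det_fin_two]
  refine ⟨fun i => (maximalPartialSpreadSet i).map φ, fun i j h => ?_, fun N => ?_⟩
  · rw [hφ, map_eq_zero_iff φ φ.injective] at h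
    exact eq_of_det_maximalPartialSpreadSet_sub_eq_zero i j h
  · obtain ⟨i, hi⟩ := exists_det_sub_maximalPartialSpreadSet_eq_zero (N.map φ.symm)
    refine ⟨i, ?_⟩
    have hN : N = (N.map φ.symm).map φ := by
      ext
      simp
    rw [hN, hφ, hi, map_zero]

theorem isMaximalPartialLineSpread_range {F V ι : Type*} [Field F] [AddCommGroup V] [Module F V]
    {n : ℕ} (φ : V ≃ₗ[F] (Fin n → F)) {f : ι → (Fin 2 → F) →ₗ[F] V}
    (hf : ∀ i j x y, x ≠ 0 → f i x = f j y → i = j ∧ x = y)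
    (hmax : ∀ m : Submodule F V, finrank F m = 2 → ∃ i x, x ≠ 0 ∧ f i x ∈ m) :
    Function.Injective (fun i => LinearMap.range (φ.toLinearMap ∘ₗ f i)) ∧
      IsMaximalPartialLineSpread F n (Set.range fun i => LinearMap.range (φ.toLinearMap ∘ₗ f i)) := by
  have hinj : ∀ i, Function.Injective (φ.toLinearMap ∘ₗ f i) := by
    intro i
    refine (injective_iff_map_eq_zero _).2 fun x hx => ?_
    by_contra hx0
    have hx' : f i x = f i 0 := by simpa using hx
    exact hx0 (hf i i x 0 hx0 hx').2
  have hmeet : ∀ i j x y, x ≠ 0 → φ (f i x) = φ (f j y) → i = j := fun i j x y hx h =>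
    (hf i j x y hx (φ.injective h)).1
  refine ⟨fun i j hij => ?_, ⟨?_, ?_⟩, fun m hm => ?_⟩
  · have hx : (1 : Fin 2 → F) ≠ 0 := one_ne_zero
    obtain ⟨y, hy⟩ : φ (f i 1) ∈ LinearMap.range (φ.toLinearMap ∘ₗ f j) :=
      hij.le ⟨1, rfl⟩
    exact hmeet i j 1 y hx hy.symm
  · rintro _ ⟨i, rfl⟩
    rw [LinearMap.finrank_range_of_inj (hinj i), finrank_fin_fun]
  · rintro _ ⟨i, rfl⟩ _ ⟨j, rfl⟩ hij
    refine (Submodule.eq_bot_iff _).2 ?_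
    rintro _ ⟨⟨x, rfl⟩, ⟨y, hy⟩⟩
    by_contra hx
    refine hij ?_
    have hx0 : x ≠ 0 := by
      rintro rfl
      exact hx (map_zero _)
    rw [hmeet i j x y hx0 hy.symm]
  · obtain ⟨i, x, hx, w, hw, hwx⟩ := hmax (m.map φ.symm.toLinearMap)
      ((LinearEquiv.finrank_map_eq φ.symm m).trans hm)
    refine ⟨_, ⟨i, rfl⟩, fun hbot => hx (hinj i ?_)⟩
    rw [map_zero]
    have hwx' : w = φ (f i x) := φ.symm_apply_eq.1 hwx
    exact (Submodule.eq_bot_iff _).1 hbot _ ⟨hwx' ▸ hw, ⟨x, rfl⟩⟩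

section LiftedLine

variable {F K τ : Type*} [Field F] [Field K] [Algebra F K]
  (e : K ≃ₗ[F] (Fin 2 → F) × (Fin 2 → F)) (M : τ → Matrix (Fin 2) (Fin 2) F)

/-- Parametrizations of the lines `0 × F²` and `{(x, M x)}` of `K × 0`, where `K ≃ F² × F²`, and
of the lines `{(c * (y, 0), y)}` of `K × F²`. -/
def liftedLine :
    Option τ ⊕ K → (Fin 2 → F) →ₗ[F] K × (Fin 2 → F)
  | .inl none => LinearMap.inl F _ _ ∘ₗ e.symm.toLinearMap ∘ₗ LinearMap.inr F _ _
  | .inl (some t) =>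
      LinearMap.inl F _ _ ∘ₗ e.symm.toLinearMap ∘ₗ LinearMap.id.prod (M t).mulVecLin
  | .inr c => ((LinearMap.mulLeft F c) ∘ₗ e.symm.toLinearMap ∘ₗ LinearMap.inl F _ _).prod .id

@[simp] theorem liftedLine_inl_none (x : Fin 2 → F) :
    liftedLine e M (.inl none) x = (e.symm (0, x), 0) := rfl

@[simp] theorem liftedLine_inl_some (t : τ) (x : Fin 2 → F) :
    liftedLine e M (.inl (some t)) x = (e.symm (x, (M t).mulVec x), 0) := rfl

@[simp] theorem liftedLine_inr (c : K) (x : Fin 2 → F) :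
    liftedLine e M (.inr c) x = (c * e.symm (x, 0), x) := rfl

theorem liftedLine_disjoint (hM : ∀ s t, (M s - M t).det = 0 → s = t) (i j : Option τ ⊕ K)
    (x y : Fin 2 → F) (hx : x ≠ 0) (h : liftedLine e M i x = liftedLine e M j y) :
    i = j ∧ x = y := by
  have h0 : e.symm (0, 0) = 0 := map_zero e.symm
  rcases i with (_ | s) | c <;> rcases j with (_ | t) | c' <;>
    simp only [liftedLine_inl_none, liftedLine_inl_some, liftedLine_inr, Prod.mk.injEq,
      EmbeddingLike.apply_eq_iff_eq] at h
  · exact ⟨rfl, h.1.2⟩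
  · obtain ⟨⟨rfl, rfl⟩, -⟩ := h
    simp at hx
  · obtain ⟨h, rfl⟩ := h
    rw [h0, mul_zero, ← h0] at h
    simp_all
  · exact absurd h.1.1 hx
  · obtain ⟨⟨rfl, h⟩, -⟩ := h
    refine ⟨?_, rfl⟩
    rw [hM s t (Matrix.exists_mulVec_eq_zero_iff.1 ⟨x, hx, by rw [Matrix.sub_mulVec, h, sub_self]⟩)]
  · obtain ⟨h, rfl⟩ := h
    rw [h0, mul_zero, ← h0] at h
    simp_all
  · exact absurd h.2 hx
  · exact absurd h.2 hx
  · obtain ⟨h, rfl⟩ := h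
    have h1 : e.symm (x, 0) ≠ 0 := by
      rw [← h0]
      simpa using hx
    exact ⟨congrArg _ (mul_right_cancel₀ h1 h), rfl⟩

theorem exists_liftedLine_mem (hM : ∀ N, ∃ t, (N - M t).det = 0)
    {m : Submodule F (K × (Fin 2 → F))} (hm : finrank F m = 2) :
    ∃ i x, x ≠ 0 ∧ liftedLine e M i x ∈ m := by
  by_contra! hcon
  have h0 : e.symm (0, 0) = 0 := map_zero e.symm
  have hsnd : ∀ z ∈ m, z.2 = 0 := by
    rintro ⟨k, y⟩ hz
    by_contra hy
    have h1 : e.symm (y, 0) ≠ 0 := by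
      rw [← h0]
      simpa using hy
    refine hcon (.inr (k / e.symm (y, 0))) y hy ?_
    rwa [liftedLine_inr, div_mul_cancel₀ _ h1]
  have : FiniteDimensional F m := FiniteDimensional.of_finrank_pos (by omega)
  let g : m →ₗ[F] (Fin 2 → F) :=
    LinearMap.fst F _ _ ∘ₗ e.toLinearMap ∘ₗ LinearMap.fst F _ _ ∘ₗ m.subtype
  let g' : m →ₗ[F] (Fin 2 → F) :=
    LinearMap.snd F _ _ ∘ₗ e.toLinearMap ∘ₗ LinearMap.fst F _ _ ∘ₗ m.subtype
  have hz : ∀ z : m, (z : K × (Fin 2 → F)) = (e.symm (g z, g' z), 0) := fun z =>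
    Prod.ext (e.symm_apply_apply _).symm (hsnd z z.2)
  have hg : Function.Injective g := by
    refine (injective_iff_map_eq_zero _).2 fun z hgz => ?_
    have h1 : g' z = 0 := by
      by_contra h
      refine hcon (.inl none) _ h ?_
      have hzm := z.2
      rwa [hz, hgz] at hzm
    refine Subtype.ext ?_
    rw [hz, hgz, h1, h0]
    rfl
  let G := LinearEquiv.ofInjectiveOfFinrankEq g hg (by rw [hm, finrank_fin_fun])
  obtain ⟨t, ht⟩ := hM (LinearMap.toMatrix' (g' ∘ₗ G.symm.toLinearMap))
  obtain ⟨x, hx, hxt⟩ := Matrix.exists_mulVec_eq_zero_iff.2 ht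
  refine hcon (.inl (some t)) x hx ?_
  rw [Matrix.sub_mulVec, sub_eq_zero, LinearMap.toMatrix'_mulVec] at hxt
  have h1 : g (G.symm x) = x := G.apply_symm_apply x
  have h2 := hz (G.symm x)
  rw [h1, show g' (G.symm x) = _ from hxt] at h2
  rw [liftedLine_inl_some, ← h2]
  exact (G.symm x).2

end LiftedLine

theorem exists_isMaximalPartialLineSpread {F : Type*} [Field F] [Fintype F]
    (hF : Fintype.card F = 5) :
    ∃ S : Set (Submodule F (Fin 6 → F)), IsMaximalPartialLineSpread F 6 S ∧ S.ncard = 647 := by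
  obtain ⟨M, hM, hM'⟩ := exists_maximal_partial_spread_set hF
  have : Fact (Nat.Prime 5) := ⟨by norm_num⟩
  have : CharP F 5 := charP_of_card_eq_prime hF
  let K := FiniteField.Extension F 5 4
  have hK : finrank F K = 4 := FiniteField.finrank_extension F 5 4
  have : FiniteDimensional F K := FiniteDimensional.of_finrank_pos (by omega)
  let e : K ≃ₗ[F] (Fin 2 → F) × (Fin 2 → F) := LinearEquiv.ofFinrankEq _ _ (by simp [hK])
  let φ : (K × (Fin 2 → F)) ≃ₗ[F] (Fin 6 → F) := LinearEquiv.ofFinrankEq _ _ (by simp [hK])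
  obtain ⟨hinj, hmax⟩ := isMaximalPartialLineSpread_range φ
    (liftedLine_disjoint e M hM) fun m hm => exists_liftedLine_mem e M hM' hm
  refine ⟨_, hmax, ?_⟩
  have hcard : Nat.card K = 625 := by
    rw [Module.natCard_eq_pow_finrank (K := F), hK, Nat.card_eq_fintype_card, hF]
    norm_num
  have : Finite K := Nat.finite_of_card_ne_zero (by omega)
  rw [← Set.image_univ, Set.ncard_image_of_injective _ hinj, Set.ncard_univ, Nat.card_sum, hcard]
  simp

/-- In PG(5,5), the largest maximal partial line spread that is not a spread
has size 647: there is a maximal partial line spread of size 647, and every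
maximal partial line spread of size greater than 647 has size 651 (a spread). -/
theorem stmt9 (F : Type*) [Field F] [Fintype F] (hq : Fintype.card F = 5) :
    (∃ S : Set (Submodule F (Fin 6 → F)),
      IsMaximalPartialLineSpread F 6 S ∧ S.ncard = 647) ∧
    (∀ S : Set (Submodule F (Fin 6 → F)),
      IsMaximalPartialLineSpread F 6 S → 647 < S.ncard → S.ncard = 651) := by
  exact ⟨exists_isMaximalPartialLineSpread hq, fun _ hS h => hS.ncard_eq hq h⟩
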